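/- Let 𝒳 be a measurable space with a σ-finite measure ν₀, let z_1,…,z_n ∈ 𝒵, and let q : 𝒳 × 𝒵 → [0,∞) satisfy ∫ q(x, z_i) dν₀(x) = 1 for each i; let ν be the product probability measure on 𝒳ⁿ whose i-th factor has density q(·, z_i) with respect to ν₀. Let μ be any probability measure on 𝒳ⁿ such that Σ_{π ∈ S_n} Π_{i=1}^n q(x_{π(i)}, z_i) > 0 for μ-almost every x. Let X ~ μ, and conditional on X let π^(1),…,π^(M) be i.i.d. permutations with probabilities proportional to Π_{i=1}^n q(X_{π(i)}, z_i); set X^(m) = X_{π^(m)}. Then for every measurable statistic T : 𝒳ⁿ → ℝ and every α ∈ [0,1], the p-value p = (1 + Σ_{m=1}^M 1{T(X^(m)) ≥ T(X)}) / (1 + M) satisfies P(p ≤ α) ≤ α + d_TV(μ, ν). (Applied with μ the true conditional law Q⋆ⁿ(·|Z) of X given (Y, Z) under the null and ν = Qⁿ(·|Z), this bounds the conditional Type I error of the conditional permutation test by α + d_TV(Q⋆ⁿ(·|Z), Qⁿ(·|Z)).) -/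

import Mathlib

open MeasureTheory
open scoped ENNReal NNReal

instance (n : ℕ) : MeasurableSpace (Equiv.Perm (Fin n)) := ⊤

/-- Total variation distance between two measures: `sup_A |μ(A) − ν(A)|` over measurable `A`. -/
noncomputable def tvDist {W : Type*} [MeasurableSpace W] (μ ν : Measure W) : ℝ :=
  ⨆ A : {A : Set W // MeasurableSet A}, |(μ A).toReal - (ν A).toReal|

/-- CPT permutation weight `Π_{i=1}^n q(x_{π(i)}, z_i)`. -/
noncomputable def cptWeight {𝒳 𝒵 : Type*} (n : ℕ) (q : 𝒳 → 𝒵 → ℝ≥0) (z : Fin n → 𝒵)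
    (x : Fin n → 𝒳) (π : Equiv.Perm (Fin n)) : ℝ≥0∞ :=
  ∏ i, (q (x (π i)) (z i) : ℝ≥0∞)

/-- The CPT distribution on permutations: `P(π) ∝ Π_i q(x_{π(i)}, z_i)`. -/
noncomputable def cptPermMeasure {𝒳 𝒵 : Type*} (n : ℕ) (q : 𝒳 → 𝒵 → ℝ≥0) (z : Fin n → 𝒵)
    (x : Fin n → 𝒳) : Measure (Equiv.Perm (Fin n)) :=
  ∑ π : Equiv.Perm (Fin n),
    (cptWeight n q z x π / ∑ π' : Equiv.Perm (Fin n), cptWeight n q z x π') • Measure.dirac π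

/-- The integral of a product of functions of single coordinates is the product of the
integrals. -/
lemma lintegral_fin_prod_eq_prod {n : ℕ} {E : Fin n → Type*} [∀ i, MeasurableSpace (E i)]
    (μ : ∀ i, Measure (E i)) [∀ i, SigmaFinite (μ i)] (f : ∀ i, E i → ℝ≥0∞)
    (hf : ∀ i, Measurable (f i)) :
    ∫⁻ x, ∏ i, f i (x i) ∂Measure.pi μ = ∏ i, ∫⁻ x, f i x ∂μ i := by
  induction n with
  | zero => simp
  | succ n ih =>
    have e := (measurePreserving_piFinSuccAbove μ 0).symm
    rw [← e.lintegral_comp_emb (MeasurableEquiv.measurableEmbedding _)]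
    simp_rw [Fin.prod_univ_succ]
    have h : ∀ a : E 0 × (∀ i : Fin n, E ((0 : Fin (n + 1)).succAbove i)),
        (f 0 ((MeasurableEquiv.piFinSuccAbove E 0).symm a 0) *
          ∏ i : Fin n, f i.succ ((MeasurableEquiv.piFinSuccAbove E 0).symm a i.succ))
        = f 0 a.1 * ∏ i : Fin n, f i.succ (a.2 i) := fun a => rfl
    simp_rw [h]
    rw [lintegral_prod_mul (f := f 0)
      (g := fun y : (∀ i : Fin n, E ((0 : Fin (n + 1)).succAbove i)) =>
        ∏ i : Fin n, f i.succ (y i)) (hf 0).aemeasurable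
      (Finset.measurable_prod _ fun i _ =>
        (hf i.succ).comp (measurable_pi_apply i)).aemeasurable]
    congr 1
    exact ih (fun i : Fin n => μ i.succ) (fun i => f i.succ) fun i => hf i.succ

/-- A product of measures with densities has the product density. -/
lemma pi_withDensity_fin {n : ℕ} {E : Fin n → Type*} [∀ i, MeasurableSpace (E i)]
    (μ : ∀ i, Measure (E i)) [∀ i, SigmaFinite (μ i)] (f : ∀ i, E i → ℝ≥0∞)
    (hf : ∀ i, Measurable (f i)) [∀ i, SigmaFinite ((μ i).withDensity (f i))] :
    Measure.pi (fun i => (μ i).withDensity (f i))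
      = (Measure.pi μ).withDensity fun x => ∏ i, f i (x i) := by
  refine Measure.pi_eq fun s hs => ?_
  rw [withDensity_apply _ (MeasurableSet.univ_pi hs), Measure.restrict_pi_pi,
    lintegral_fin_prod_eq_prod _ f hf]
  exact Finset.prod_congr rfl fun i _ => (withDensity_apply _ (hs i)).symm

/-- A function with values in `[0, 1]` has integrals under two probability measures differing by
at most their total variation distance. -/
lemma integral_le_integral_add_tvDist {W : Type*} [MeasurableSpace W] (μ ν : Measure W)
    [IsProbabilityMeasure μ] [IsProbabilityMeasure ν] (f : W → ℝ) (hf : Measurable f)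
    (h0 : ∀ x, 0 ≤ f x) (h1 : ∀ x, f x ≤ 1) :
    ∫ x, f x ∂μ ≤ ∫ x, f x ∂ν + tvDist μ ν := by
  have hbdd : BddAbove (Set.range fun A : {A : Set W // MeasurableSet A} =>
      |(μ A).toReal - (ν A).toReal|) := by
    refine ⟨1, ?_⟩
    rintro _ ⟨A, rfl⟩
    exact abs_sub_le_of_nonneg_of_le ENNReal.toReal_nonneg (measureReal_le_one (μ := μ))
      ENNReal.toReal_nonneg (measureReal_le_one (μ := ν))
  have key : ∀ A, MeasurableSet A → μ.real A ≤ ν.real A + tvDist μ ν := fun A hA => by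
    have := (le_abs_self _).trans (le_ciSup hbdd ⟨A, hA⟩)
    simp only [Measure.real, tvDist]
    linarith
  have hint : ∀ (ρ : Measure W) [IsProbabilityMeasure ρ], Integrable f ρ := fun ρ _ =>
    Integrable.of_bound hf.aestronglyMeasurable 1 <| .of_forall fun x => by
      rw [Real.norm_eq_abs, abs_of_nonneg (h0 x)]; exact h1 x
  have hlevel : ∀ (ρ : Measure W) [IsProbabilityMeasure ρ],
      IntegrableOn (fun t => ρ.real {a | t ≤ f a}) (Set.Ioc 0 1) := fun ρ _ => by
    have hanti : Antitone fun t => ρ.real {a | t ≤ f a} := fun s t hst =>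
      measureReal_mono fun a ha => hst.trans ha
    exact (hanti.antitoneOn _).integrableOn_isCompact isCompact_Icc |>.mono_set
      Set.Ioc_subset_Icc_self
  rw [(hint μ).integral_eq_integral_Ioc_meas_le (.of_forall h0) (.of_forall h1),
    (hint ν).integral_eq_integral_Ioc_meas_le (.of_forall h0) (.of_forall h1)]
  calc _ ≤ ∫ t in Set.Ioc (0 : ℝ) 1, (ν.real {a | t ≤ f a} + tvDist μ ν) :=
        setIntegral_mono (hlevel μ) ((hlevel ν).add (integrableOn_const (by simp)))
          fun t => key _ (measurableSet_le measurable_const hf)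
    _ = _ := by
      rw [integral_add (hlevel ν) (integrableOn_const (by simp))]
      simp

/-- At most `r` indices have upper rank at most `r`. -/
lemma card_filter_card_le {κ : Type*} [Fintype κ] (t : κ → ℝ) {r : ℝ} (hr : 0 ≤ r) :
    ((Finset.univ.filter fun j =>
      ((Finset.univ.filter fun k => t j ≤ t k).card : ℝ) ≤ r).card : ℝ) ≤ r := by
  set A := Finset.univ.filter fun j => ((Finset.univ.filter fun k => t j ≤ t k).card : ℝ) ≤ r
    with hA
  rcases A.eq_empty_or_nonempty with h | h
  · simpa [h] using hr
  · obtain ⟨j, hj, hmin⟩ := A.exists_min_image t h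
    refine le_trans ?_ (Finset.mem_filter.mp hj).2
    exact_mod_cast Finset.card_le_card fun k hk =>
      Finset.mem_filter.mpr ⟨Finset.mem_univ _, hmin k hk⟩

/-- Among `M + 1` independent draws, the upper rank of the first one is sub-uniform. -/
lemma sum_prod_rank_le {ι : Type*} [Fintype ι] (M : ℕ) (p : ι → ℝ≥0∞) (hp : ∑ i, p i ≤ 1)
    (t : ι → ℝ) {r : ℝ} (hr : 0 ≤ r) :
    ((M : ℝ≥0∞) + 1) * ∑ s : Fin (M + 1) → ι, (∏ j, p (s j)) *
      (if ((Finset.univ.filter fun k => t (s 0) ≤ t (s k)).card : ℝ) ≤ r then 1 else 0)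
      ≤ ENNReal.ofReal r := by
  classical
  set F : Fin (M + 1) → (Fin (M + 1) → ι) → ℝ≥0∞ := fun j s => (∏ j, p (s j)) *
      (if ((Finset.univ.filter fun k => t (s j) ≤ t (s k)).card : ℝ) ≤ r then 1 else 0) with hF
  have hswap : ∀ j, ∑ s, F j s = ∑ s, F 0 s := fun j => by
    refine Fintype.sum_equiv ((Equiv.swap 0 j).arrowCongr (Equiv.refl ι)) _ _ fun s => ?_
    have hcard : (Finset.univ.filter fun k => t (s j) ≤ t (s (Equiv.swap 0 j k))).card
        = (Finset.univ.filter fun k => t (s j) ≤ t (s k)).card := by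
      refine Finset.card_equiv (Equiv.swap 0 j) fun k => by simp
    simp [hF, hcard, Equiv.prod_comp (Equiv.swap 0 j) fun k => p (s k)]
  calc ((M : ℝ≥0∞) + 1) * ∑ s, F 0 s = ∑ j, ∑ s, F j s := by simp [hswap]
    _ = ∑ s : Fin (M + 1) → ι, (∏ j, p (s j)) *
        ((Finset.univ.filter fun j =>
          ((Finset.univ.filter fun k => t (s j) ≤ t (s k)).card : ℝ) ≤ r).card : ℝ≥0∞) := by
      rw [Finset.sum_comm]
      simp only [hF, ← Finset.mul_sum, Finset.sum_boole]
    _ ≤ ∑ s : Fin (M + 1) → ι, (∏ j, p (s j)) * ENNReal.ofReal r := by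
      gcongr with s
      rw [← ENNReal.ofReal_natCast]
      exact ENNReal.ofReal_le_ofReal (card_filter_card_le (fun j => t (s j)) hr)
    _ = (∑ i, p i) ^ (M + 1) * ENNReal.ofReal r := by
      rw [← Finset.sum_mul, Fintype.sum_pow]
    _ ≤ ENNReal.ofReal r := mul_le_of_le_one_left' (pow_le_one' hp _)

/-- `sum_prod_rank_le` in terms of the p-value of the first draw against the others. -/
lemma sum_prod_pvalue_le {ι : Type*} [Fintype ι] (M : ℕ) (p : ι → ℝ≥0∞) (hp : ∑ i, p i ≤ 1)
    (t : ι → ℝ) {α : ℝ} (hα : 0 ≤ α) :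
    ∑ i, p i * ∑ s : Fin M → ι, (∏ m, p (s m)) *
      (if (1 + ((Finset.univ.filter fun m => t i ≤ t (s m)).card : ℝ)) / (1 + M) ≤ α
        then 1 else 0) ≤ ENNReal.ofReal α := by
  have hM : (0 : ℝ) < 1 + M := by positivity
  have h := sum_prod_rank_le M p hp t (mul_nonneg hα hM.le)
  rw [ENNReal.ofReal_mul hα, mul_comm (ENNReal.ofReal α), ENNReal.ofReal_add zero_le_one
    (Nat.cast_nonneg _), ENNReal.ofReal_one, ENNReal.ofReal_natCast, add_comm (1 : ℝ≥0∞),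
    ENNReal.mul_le_mul_iff_right (by simp) (by simp)] at h
  refine le_of_eq_of_le ?_ h
  rw [← (Fin.consEquiv fun _ => ι).sum_comp, Fintype.sum_prod_type]
  refine Finset.sum_congr rfl fun i _ => ?_
  rw [Finset.mul_sum]
  refine Finset.sum_congr rfl fun s _ => ?_
  simp_rw [div_le_iff₀ hM]
  simp [Fin.consEquiv, Fin.prod_univ_succ, Fin.card_filter_univ_succ, add_comm]

section cpt

variable {𝒳 𝒵 : Type*} {n : ℕ} {q : 𝒳 → 𝒵 → ℝ≥0} {z : Fin n → 𝒵}

lemma sum_cptWeight_div_le_one (x : Fin n → 𝒳) :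
    ∑ π, cptWeight n q z x π / ∑ π', cptWeight n q z x π' ≤ 1 := by
  simp_rw [div_eq_mul_inv, ← Finset.sum_mul]
  exact ENNReal.div_self_le_one

lemma cptPermMeasure_singleton (x : Fin n → 𝒳) (π : Equiv.Perm (Fin n)) :
    cptPermMeasure n q z x {π} = cptWeight n q z x π / ∑ π', cptWeight n q z x π' := by
  simp [cptPermMeasure, Set.indicator_apply]

instance isFiniteMeasure_cptPermMeasure (x : Fin n → 𝒳) :
    IsFiniteMeasure (cptPermMeasure n q z x) := by
  refine ⟨lt_of_le_of_lt ?_ ENNReal.one_lt_top⟩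
  simpa [cptPermMeasure] using sum_cptWeight_div_le_one (q := q) (z := z) x

lemma map_pi_cptPermMeasure_apply [MeasurableSpace 𝒳] (M : ℕ) (x : Fin n → 𝒳)
    {S : Set ((Fin n → 𝒳) × (Fin M → Equiv.Perm (Fin n)))} (hS : MeasurableSet S) :
    ((Measure.pi fun _ : Fin M => cptPermMeasure n q z x).map fun πs => (x, πs)) S
      = ∑ πs : Fin M → Equiv.Perm (Fin n),
        (∏ m, (cptWeight n q z x (πs m) / ∑ π', cptWeight n q z x π')) *
          S.indicator 1 (x, πs) := by
  rw [Measure.map_apply measurable_prodMk_left hS, ← lintegral_indicator_one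
    (measurable_prodMk_left hS), lintegral_fintype]
  refine Finset.sum_congr rfl fun πs _ => ?_
  rw [Measure.pi_singleton, mul_comm]
  simp_rw [cptPermMeasure_singleton]
  rfl

lemma measurable_cptWeight [MeasurableSpace 𝒳] (hq : ∀ i, Measurable fun x => q x (z i))
    (π : Equiv.Perm (Fin n)) : Measurable fun x => cptWeight n q z x π :=
  Finset.measurable_prod _ fun i _ =>
    ((hq i).comp (measurable_pi_apply (π i))).coe_nnreal_ennreal

lemma measurable_map_pi_cptPermMeasure [MeasurableSpace 𝒳] (M : ℕ)
    (hq : ∀ i, Measurable fun x => q x (z i)) :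
    Measurable fun x =>
      (Measure.pi fun _ : Fin M => cptPermMeasure n q z x).map fun πs => (x, πs) := by
  refine Measure.measurable_of_measurable_coe _ fun S hS => ?_
  simp_rw [map_pi_cptPermMeasure_apply M _ hS]
  refine Finset.measurable_sum _ fun πs _ => .mul (Finset.measurable_prod _ fun m _ =>
    (measurable_cptWeight hq _).div (Finset.measurable_sum _ fun π _ =>
      measurable_cptWeight hq π)) ?_
  exact (measurable_one.indicator hS).comp measurable_prodMk_right

/-- Averaging over the orbit of `x` under permutations, the conditional permutation test has
size at most `α`. -/
lemma sum_perm_pvalue_mul_cptWeight_le (M : ℕ) (x : Fin n → 𝒳) (T : (Fin n → 𝒳) → ℝ) {α : ℝ}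
    (hα : 0 ≤ α) :
    ∑ σ : Equiv.Perm (Fin n), cptWeight n q z x σ * ∑ πs : Fin M → Equiv.Perm (Fin n),
      (∏ m, (cptWeight n q z (x ∘ σ) (πs m) / ∑ π', cptWeight n q z (x ∘ σ) π')) *
      (if (1 + ((Finset.univ.filter fun m => T (x ∘ σ) ≤ T (x ∘ σ ∘ πs m)).card : ℝ)) / (1 + M)
        ≤ α then 1 else 0) ≤ ENNReal.ofReal α * ∑ σ, cptWeight n q z x σ := by
  set W := ∑ π', cptWeight n q z x π' with hW
  have hcomp : ∀ σ π : Equiv.Perm (Fin n), cptWeight n q z (x ∘ σ) π = cptWeight n q z x (σ * π) :=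
    fun _ _ => rfl
  have hWσ : ∀ σ : Equiv.Perm (Fin n), ∑ π', cptWeight n q z (x ∘ σ) π' = W := fun σ =>
    Equiv.sum_comp (Equiv.mulLeft σ) fun π => cptWeight n q z x π
  by_cases h0 : W = 0
  · have : ∀ σ, cptWeight n q z x σ = 0 := fun σ =>
      (Finset.sum_eq_zero_iff.mp h0) σ (Finset.mem_univ σ)
    simp [this]
  have htop : W ≠ ∞ := by
    exact ENNReal.sum_ne_top.mpr fun π _ => ENNReal.prod_ne_top fun i _ => ENNReal.coe_ne_top
  have hdiv : ∀ σ, cptWeight n q z x σ = W * (cptWeight n q z x σ / W) := fun σ =>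
    (ENNReal.mul_div_cancel h0 htop).symm
  have h := sum_prod_pvalue_le M (fun σ => cptWeight n q z x σ / W)
    (sum_cptWeight_div_le_one x) (fun σ => T (x ∘ σ)) hα
  rw [mul_comm]
  refine le_of_eq_of_le ?_ (mul_le_mul_right h W)
  rw [Finset.mul_sum]
  refine Finset.sum_congr rfl fun σ _ => ?_
  rw [← mul_assoc, ← hdiv σ]
  congr 1
  refine Fintype.sum_equiv (Equiv.piCongrRight fun _ => Equiv.mulLeft σ) _ _ fun πs => ?_
  simp_rw [hWσ]
  simp [hcomp]

/-- Integrals over a power measure are invariant under averaging over coordinate permutations. -/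
lemma sum_perm_lintegral_comp [MeasurableSpace 𝒳] (ν₀ : Measure 𝒳) [SigmaFinite ν₀]
    (F : (Fin n → 𝒳) → ℝ≥0∞) (hF : Measurable F) :
    ∫⁻ x, ∑ σ : Equiv.Perm (Fin n), F (x ∘ σ) ∂(Measure.pi fun _ : Fin n => ν₀)
      = (n.factorial : ℝ≥0∞) * ∫⁻ x, F x ∂(Measure.pi fun _ : Fin n => ν₀) := by
  have hmp : ∀ σ : Equiv.Perm (Fin n), MeasurePreserving (fun x : Fin n → 𝒳 => x ∘ σ)
      (Measure.pi fun _ => ν₀) (Measure.pi fun _ => ν₀) := fun σ =>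
    measurePreserving_arrowCongr' (fun _ : Fin n => ν₀) (fun _ => ν₀) σ.symm
      (MeasurableEquiv.refl 𝒳) fun _ => .id ν₀
  rw [lintegral_finsetSum (f := fun (σ : Equiv.Perm (Fin n)) x => F (x ∘ σ)) _ fun σ _ =>
    hF.comp (hmp σ).measurable]
  simp [fun σ => (hmp σ).lintegral_comp hF, Fintype.card_perm]

end cpt

/-- **Robustness of the conditional permutation test (Theorem 3, CPT case).**
Let `ν = ⨂_i ν₀.withDensity q(·,z_i)` be the product law with conditional densities `q`, and
let `X ~ μ` for an arbitrary probability measure `μ` on `𝒳ⁿ` (a.s. positive total weight).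
Conditionally on `X`, draw `π⁽¹⁾,…,π⁽ᴹ⁾` i.i.d. with `P(π⁽ᵐ⁾ = π | X) ∝ Π_i q(X_{π(i)},z_i)`
and set `X⁽ᵐ⁾ = X_{π⁽ᵐ⁾}`. Then for every measurable statistic `T` and `α ∈ [0,1]`, the
p-value `p = (1 + Σ_m 1{T(X⁽ᵐ⁾) ≥ T(X)})/(1+M)` satisfies `P(p ≤ α) ≤ α + d_TV(μ,ν)`. -/
theorem cpt_robust_type_I_error {𝒳 𝒵 : Type*} [MeasurableSpace 𝒳]
    (ν₀ : Measure 𝒳) [SigmaFinite ν₀] (n : ℕ) (z : Fin n → 𝒵)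
    (q : 𝒳 → 𝒵 → ℝ≥0) (hqmeas : ∀ i, Measurable fun x => q x (z i))
    (hq1 : ∀ i, ∫⁻ x, (q x (z i) : ℝ≥0∞) ∂ν₀ = 1)
    (μ : Measure (Fin n → 𝒳)) [IsProbabilityMeasure μ]
    (hpos : ∀ᵐ x ∂μ, 0 < ∑ π' : Equiv.Perm (Fin n), cptWeight n q z x π')
    (M : ℕ) (hM : 1 ≤ M)
    (P : Measure ((Fin n → 𝒳) × (Fin M → Equiv.Perm (Fin n))))
    (hP : P = μ.bind fun x =>
      (Measure.pi fun _ : Fin M => cptPermMeasure n q z x).map fun πs => (x, πs))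
    (T : (Fin n → 𝒳) → ℝ) (hT : Measurable T) (α : ℝ) (hα : α ∈ Set.Icc (0 : ℝ) 1) :
    P {ω | (1 + ((Finset.univ.filter fun m : Fin M =>
          T ω.1 ≤ T fun i => ω.1 (ω.2 m i)).card) : ℝ) / (1 + M) ≤ α}
      ≤ ENNReal.ofReal
          (α + tvDist μ (Measure.pi fun i => ν₀.withDensity fun x => (q x (z i) : ℝ≥0∞))) := by
  set ν := Measure.pi fun i => ν₀.withDensity fun x => (q x (z i) : ℝ≥0∞) with hν
  have hdens : ∀ i, IsProbabilityMeasure (ν₀.withDensity fun x => (q x (z i) : ℝ≥0∞)) :=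
    fun i => ⟨by simpa using hq1 i⟩
  have hνeq : ν = (Measure.pi fun _ => ν₀).withDensity fun x => cptWeight n q z x 1 :=
    pi_withDensity_fin (fun _ => ν₀) (fun i x => (q x (z i) : ℝ≥0∞))
      fun i => (hqmeas i).coe_nnreal_ennreal
  set E := {ω : (Fin n → 𝒳) × (Fin M → Equiv.Perm (Fin n)) |
    (1 + ((Finset.univ.filter fun m : Fin M =>
      T ω.1 ≤ T fun i => ω.1 (ω.2 m i)).card) : ℝ) / (1 + M) ≤ α} with hEdef
  have hE : MeasurableSet E := by
    refine measurableSet_le ?_ measurable_const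
    refine measurable_from_prod_countable_left fun πs => ?_
    simp only [Finset.card_filter, Nat.cast_sum]
    refine (measurable_const.add (Finset.measurable_sum _ fun m _ => ?_)).div_const _
    refine measurable_from_nat.comp (Measurable.ite (measurableSet_le hT (hT.comp ?_))
      measurable_const measurable_const)
    exact measurable_pi_lambda _ fun i => measurable_pi_apply _
  set h : (Fin n → 𝒳) → ℝ≥0∞ := fun x =>
    ((Measure.pi fun _ : Fin M => cptPermMeasure n q z x).map fun πs => (x, πs)) E with hh
  have hK := measurable_map_pi_cptPermMeasure (z := z) M hqmeas
  have hmeas : Measurable h := (Measure.measurable_coe hE).comp hK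
  have hle : ∀ x, h x ≤ 1 := fun x => by
    refine (measure_mono (Set.subset_univ _)).trans ?_
    rw [Measure.map_apply measurable_prodMk_left .univ, Set.preimage_univ, Measure.pi_univ]
    refine Finset.prod_le_one' fun m _ => ?_
    simpa [cptPermMeasure] using sum_cptWeight_div_le_one (q := q) (z := z) x
  have hPE : P E = ∫⁻ x, h x ∂μ := by
    rw [hP, Measure.bind_apply hE hK.aemeasurable]
  have hνle : ∫⁻ x, h x ∂ν ≤ ENNReal.ofReal α := by
    have hw := measurable_cptWeight (n := n) (z := z) hqmeas
    have hfac : (n.factorial : ℝ≥0∞) ≠ 0 := by simp [n.factorial_ne_zero]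
    rw [← ENNReal.mul_le_mul_iff_right hfac (by simp), hνeq,
      lintegral_withDensity_eq_lintegral_mul _ (hw 1) hmeas,
      ← sum_perm_lintegral_comp ν₀ _ ((hw 1).mul hmeas)]
    calc _ ≤ ∫⁻ x, ENNReal.ofReal α * ∑ σ : Equiv.Perm (Fin n), cptWeight n q z (x ∘ σ) 1
          ∂(Measure.pi fun _ : Fin n => ν₀) := by
          refine lintegral_mono fun x => ?_
          refine le_of_eq_of_le ?_ (sum_perm_pvalue_mul_cptWeight_le M x T hα.1)
          refine Finset.sum_congr rfl fun σ _ => ?_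
          rw [Pi.mul_apply]
          congr 1
          simp only [hh]
          rw [map_pi_cptPermMeasure_apply M _ hE]
          refine Finset.sum_congr rfl fun πs _ => ?_
          congr 1
      _ = (n.factorial : ℝ≥0∞) * (ENNReal.ofReal α * ν Set.univ) := by
          rw [lintegral_const_mul' _ _ ENNReal.ofReal_ne_top,
            sum_perm_lintegral_comp ν₀ (fun x => cptWeight n q z x 1) (hw 1), hνeq,
            withDensity_apply _ .univ, Measure.restrict_univ, mul_left_comm]
      _ = _ := by rw [measure_univ, mul_one]
  have htv := integral_le_integral_add_tvDist μ ν (fun x => (h x).toReal) hmeas.ennreal_toReal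
    (fun x => ENNReal.toReal_nonneg)
    fun x => ENNReal.toReal_le_of_le_ofReal zero_le_one (by simpa using hle x)
  have hfin : ∀ x, h x < ∞ := fun x => (hle x).trans_lt ENNReal.one_lt_top
  rw [integral_toReal hmeas.aemeasurable (.of_forall hfin),
    integral_toReal hmeas.aemeasurable (.of_forall hfin)] at htv
  have hμtop : ∫⁻ x, h x ∂μ ≠ ∞ :=
    ((lintegral_mono hle).trans_lt (by simp)).ne
  rw [hPE, ← ENNReal.ofReal_toReal hμtop]
  refine ENNReal.ofReal_le_ofReal (htv.trans ?_)
  gcongr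
  exact ENNReal.toReal_le_of_le_ofReal hα.1 hνle
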